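/- arXiv:1503.07184 — 2 statements merged into one kernel-verified Lean document; each statement's English description precedes it below -/
import Mathlib

section
/- For every pentad {v1, v2, v3, v4, v5}, the multiset consisting of seven cubes of each of the varieties v1, v2, v3 together with one cube of each of the varieties v4 and v5 (23 cubes in all) contains no corner solution. In particular, there exists a multiset of 23 colored cubes containing no corner solution. -/
open scoped Classical

/-- A colored cube: a bijection assigning to each face (`Fin 6`) a color (`Fin 6`). -/
abbrev CCube := Equiv.Perm (Fin 6)

/-- The opposite-face involution: face `i` is opposite face `i + 3`. -/
def tau (i : Fin 6) : Fin 6 := i + 3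

/-- Quarter-turn rotation about the axis through the face pair `{2, 5}`. -/
def r1 : Equiv.Perm (Fin 6) := ([0, 1, 3, 4] : List (Fin 6)).formPerm

/-- Quarter-turn rotation about the axis through the face pair `{0, 3}`. -/
def r2 : Equiv.Perm (Fin 6) := ([1, 2, 4, 5] : List (Fin 6)).formPerm

/-- The rotation group of the cube, acting on the set of faces. -/
def G : Subgroup (Equiv.Perm (Fin 6)) := Subgroup.closure {r1, r2}

/-- Two colored cubes have the same variety iff one is obtained from the other by
precomposition with a rotation. -/
def sameVariety (c d : CCube) : Prop := ∃ g ∈ G, d = c * g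

def varietySetoid : Setoid CCube where
  r := sameVariety
  iseqv := by
    refine ⟨fun c => ⟨1, G.one_mem, (mul_one c).symm⟩, ?_, ?_⟩
    · rintro c d ⟨g, hg, rfl⟩
      exact ⟨g⁻¹, G.inv_mem hg, by group⟩
    · rintro a b c ⟨g, hg, rfl⟩ ⟨h, hh, rfl⟩
      exact ⟨g * h, G.mul_mem hg hh, by group⟩

/-- A variety is a `G`-orbit of colored cubes. -/
def Variety := Quotient varietySetoid

/-- The variety of a colored cube. -/
def varietyOf (c : CCube) : Variety := Quotient.mk varietySetoid c

/-- The three opposite pairs of colors of a colored cube. -/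
def oppPairs (c : CCube) : Finset (Finset (Fin 6)) :=
  Finset.image (fun i => ({c i, c (tau i)} : Finset (Fin 6))) Finset.univ

/-- The twelve adjacent pairs of colors of a colored cube. -/
def adjPairs (c : CCube) : Finset (Finset (Fin 6)) :=
  Finset.image (fun p : Fin 6 × Fin 6 => ({c p.1, c p.2} : Finset (Fin 6)))
    (Finset.univ.filter (fun p : Fin 6 × Fin 6 => p.2 ≠ p.1 ∧ p.2 ≠ tau p.1))

/-- The mirror cube of `c`. -/
def mirror (c : CCube) : CCube := c * Equiv.swap 0 3

/-- Cyclic rotation of an ordered triple. -/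
def cyc (t : Fin 6 × Fin 6 × Fin 6) : Fin 6 × Fin 6 × Fin 6 := (t.2.1, t.2.2, t.1)

/-- The cyclic equivalence class of an ordered triple. -/
def cycClass (t : Fin 6 × Fin 6 × Fin 6) : Finset (Fin 6 × Fin 6 × Fin 6) :=
  {t, cyc t, cyc (cyc t)}

/-- The eight corner triples of a colored cube: faces `0, 1, 2` meet at a corner, read
clockwise, and the corners of the cube are the images of this corner under rotations. -/
noncomputable def cornerTriples (c : CCube) : Finset (Finset (Fin 6 × Fin 6 × Fin 6)) :=
  Finset.univ.filter (fun s => ∃ g ∈ G, s = cycClass (c (g 0), c (g 1), c (g 2)))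

/-- The opposite pairs of a variety. -/
noncomputable def vOpp (v : Variety) : Finset (Finset (Fin 6)) := oppPairs (Quotient.out v)

/-- The adjacent pairs of a variety. -/
noncomputable def vAdj (v : Variety) : Finset (Finset (Fin 6)) := adjPairs (Quotient.out v)

/-- The corner triples of a variety. -/
noncomputable def vCorners (v : Variety) : Finset (Finset (Fin 6 × Fin 6 × Fin 6)) :=
  cornerTriples (Quotient.out v)

/-- The mirror variety of a variety. -/
noncomputable def vMirror (v : Variety) : Variety := varietyOf (mirror (Quotient.out v))

/-- A pentad: five varieties which pairwise share no corner triples and whose fifteen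
opposite pairs comprise each unordered pair of colors exactly once. -/
def IsPentad (P : Finset Variety) : Prop :=
  P.card = 5 ∧
  (∀ v ∈ P, ∀ w ∈ P, v ≠ w → vCorners v ∩ vCorners w = ∅) ∧
  (∀ p : Finset (Fin 6), p.card = 2 → ∃! v, v ∈ P ∧ p ∈ vOpp v)

/-- A corner solution from the multiset `S` modeled on the cube `m`: eight distinct cube
instances from `S` in bijection with the eight corner triples of `m`, each chosen cube having
its assigned corner triple among its own corner triples. -/
def CornerSolutionOn (S : Multiset CCube) (m : CCube) : Prop :=
  ∃ ψ : Finset (Fin 6 × Fin 6 × Fin 6) → CCube,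
    Multiset.map ψ (cornerTriples m).val ≤ S ∧
    ∀ t ∈ cornerTriples m, t ∈ cornerTriples (ψ t)

/-- `S` contains a corner solution modeled on some variety. -/
def HasCornerSolution (S : Multiset CCube) : Prop := ∃ m : CCube, CornerSolutionOn S m

/-- An `n`-frame solution from `S` modeled on the cube `m`: a corner solution together with,
for each of the twelve adjacent pairs of `m`, a further `n - 2` cube instances having that
adjacent pair, all `12n - 16` cube instances distinct. -/
def FrameSolutionOn (n : ℕ) (S : Multiset CCube) (m : CCube) : Prop :=
  ∃ (ψ : Finset (Fin 6 × Fin 6 × Fin 6) → CCube) (f : Finset (Fin 6) → Multiset CCube),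
    (∀ t ∈ cornerTriples m, t ∈ cornerTriples (ψ t)) ∧
    (∀ p ∈ adjPairs m, Multiset.card (f p) = n - 2 ∧ ∀ x ∈ f p, p ∈ adjPairs x) ∧
    Multiset.map ψ (cornerTriples m).val + (adjPairs m).sum f ≤ S

/-- `S` contains an `n`-frame solution modeled on some variety. -/
def HasFrameSolution (n : ℕ) (S : Multiset CCube) : Prop := ∃ m : CCube, FrameSolutionOn n S m

/-- Ordered triples of faces (or of colors). -/
abbrev Triple := Fin 6 × Fin 6 × Fin 6

/-- Apply a permutation to each entry of a triple. -/
def recolor (p : Equiv.Perm (Fin 6)) (t : Triple) : Triple := (p t.1, p t.2.1, p t.2.2)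

/-- The clockwise face triples around the corners of the cube: the entries lie on the three
distinct axes, in a cyclic order determined by the parity of their sum. -/
def IsClockwise (t : Triple) : Prop :=
  (t.2.1.val % 3 = (t.1.val + 1) % 3 ∧ t.2.2.val % 3 = (t.1.val + 2) % 3 ∧
    (t.1.val + t.2.1.val + t.2.2.val) % 2 = 1) ∨
  (t.2.1.val % 3 = (t.1.val + 2) % 3 ∧ t.2.2.val % 3 = (t.1.val + 1) % 3 ∧
    (t.1.val + t.2.1.val + t.2.2.val) % 2 = 0)

instance : DecidablePred IsClockwise := fun _ => inferInstanceAs (Decidable (_ ∨ _))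

/-- The corners of the cube, each read from its face on the axis through `{0, 3}`. -/
def cornerReps : Finset Triple :=
  {(0, 1, 2), (0, 2, 4), (0, 4, 5), (0, 5, 1), (3, 1, 5), (3, 2, 1), (3, 4, 2), (3, 5, 4)}

lemma recolor_mul (p q : Equiv.Perm (Fin 6)) (t : Triple) :
    recolor (p * q) t = recolor p (recolor q t) := rfl

lemma recolor_inv_recolor (p : Equiv.Perm (Fin 6)) (t : Triple) :
    recolor p⁻¹ (recolor p t) = t := by
  simp [recolor]

lemma recolor_recolor_inv (p : Equiv.Perm (Fin 6)) (t : Triple) :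
    recolor p (recolor p⁻¹ t) = t := by
  simp [recolor]

lemma recolor_injective (p : Equiv.Perm (Fin 6)) : Function.Injective (recolor p) :=
  Function.LeftInverse.injective (recolor_inv_recolor p)

lemma isClockwise_cyc (t : Triple) : IsClockwise (cyc t) ↔ IsClockwise t := by
  revert t; decide +kernel

lemma cycClass_cyc (t : Triple) : cycClass (cyc t) = cycClass t := by
  ext u
  simp only [cycClass, Finset.mem_insert, Finset.mem_singleton]
  have h : cyc (cyc (cyc t)) = t := rfl
  rw [h]
  tauto

lemma eq_of_cycClass_eq {t u : Triple} (h : cycClass t = cycClass u) :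
    t = u ∨ t = cyc u ∨ t = cyc (cyc u) := by
  have ht : t ∈ cycClass t := by simp [cycClass]
  rw [h] at ht
  simpa [cycClass] using ht

lemma isClockwise_recolor_congr {t u : Triple} (h : cycClass t = cycClass u)
    (p : Equiv.Perm (Fin 6)) : IsClockwise (recolor p t) ↔ IsClockwise (recolor p u) := by
  rcases eq_of_cycClass_eq h with rfl | rfl | rfl
  · rfl
  · exact isClockwise_cyc (recolor p u)
  · exact (isClockwise_cyc (cyc (recolor p u))).trans (isClockwise_cyc (recolor p u))

lemma isClockwise_r1 (t : Triple) : IsClockwise (recolor r1 t) ↔ IsClockwise t := by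
  revert t; decide +kernel

lemma isClockwise_r2 (t : Triple) : IsClockwise (recolor r2 t) ↔ IsClockwise t := by
  revert t; decide +kernel

lemma isClockwise_recolor_of_mem {g : Equiv.Perm (Fin 6)} (hg : g ∈ G) (t : Triple) :
    IsClockwise (recolor g t) ↔ IsClockwise t := by
  revert t
  refine Subgroup.closure_induction (p := fun g _ => ∀ t, IsClockwise (recolor g t) ↔ IsClockwise t)
    ?_ ?_ ?_ ?_ hg
  · rintro x (rfl | rfl)
    exacts [isClockwise_r1, isClockwise_r2]
  · exact fun _ => Iff.rfl
  · exact fun x y _ _ hx hy t => (hx _).trans (hy t)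
  · intro x _ hx t
    rw [← hx, recolor_recolor_inv]

lemma exists_word_of_isClockwise : ∀ t : Triple, IsClockwise t →
    ∃ a b c : Fin 4, t = recolor (r1 ^ a.val * r2 ^ b.val * r1 ^ c.val) (0, 1, 2) := by
  decide +kernel

lemma exists_rotation_of_isClockwise {t : Triple} (ht : IsClockwise t) :
    ∃ g ∈ G, t = recolor g (0, 1, 2) := by
  obtain ⟨a, b, c, h⟩ := exists_word_of_isClockwise t ht
  have h1 : r1 ∈ G := Subgroup.subset_closure (by simp)
  have h2 : r2 ∈ G := Subgroup.subset_closure (by simp)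
  exact ⟨_, G.mul_mem (G.mul_mem (G.pow_mem h1 _) (G.pow_mem h2 _)) (G.pow_mem h1 _), h⟩

lemma mem_cornerTriples {c : CCube} {s : Finset Triple} :
    s ∈ cornerTriples c ↔ ∃ t, IsClockwise t ∧ s = cycClass (recolor c t) := by
  simp only [cornerTriples, Finset.mem_filter, Finset.mem_univ, true_and]
  constructor
  · rintro ⟨g, hg, rfl⟩
    exact ⟨recolor g (0, 1, 2), (isClockwise_recolor_of_mem hg _).2 (by decide), rfl⟩
  · rintro ⟨t, ht, rfl⟩
    obtain ⟨g, hg, rfl⟩ := exists_rotation_of_isClockwise ht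
    exact ⟨g, hg, rfl⟩

lemma cycClass_mem_cornerTriples {c : CCube} {t : Triple} :
    cycClass t ∈ cornerTriples c ↔ IsClockwise (recolor c⁻¹ t) := by
  rw [mem_cornerTriples]
  constructor
  · rintro ⟨u, hu, h⟩
    rwa [isClockwise_recolor_congr h, recolor_inv_recolor]
  · exact fun h => ⟨_, h, by rw [recolor_recolor_inv]⟩

lemma isClockwise_of_mem_cornerReps : ∀ t ∈ cornerReps, IsClockwise t := by
  decide +kernel

lemma exists_cornerRep : ∀ t : Triple, IsClockwise t →
    t ∈ cornerReps ∨ cyc t ∈ cornerReps ∨ cyc (cyc t) ∈ cornerReps := by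
  decide +kernel

lemma cornerReps_eq_of_cyc : ∀ t ∈ cornerReps, ∀ u ∈ cornerReps,
    t = u ∨ t = cyc u ∨ t = cyc (cyc u) → t = u := by
  decide +kernel

lemma cornerTriples_eq_image (c : CCube) :
    cornerTriples c = cornerReps.image fun t => cycClass (recolor c t) := by
  ext s
  rw [mem_cornerTriples, Finset.mem_image]
  constructor
  · rintro ⟨t, ht, rfl⟩
    have h1 (u : Triple) : cycClass (recolor c (cyc u)) = cycClass (recolor c u) :=
      cycClass_cyc (recolor c u)
    rcases exists_cornerRep t ht with h | h | h
    exacts [⟨_, h, rfl⟩, ⟨_, h, h1 t⟩, ⟨_, h, (h1 _).trans (h1 t)⟩]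
  · rintro ⟨t, ht, rfl⟩
    exact ⟨t, isClockwise_of_mem_cornerReps t ht, rfl⟩

lemma injOn_cycClass_recolor (c : CCube) :
    Set.InjOn (fun t => cycClass (recolor c t)) (cornerReps : Set Triple) := by
  intro t ht u hu h
  refine cornerReps_eq_of_cyc t ht u hu ?_
  rcases eq_of_cycClass_eq h with h | h | h
  · exact .inl (recolor_injective c h)
  · exact .inr (.inl (recolor_injective c h))
  · exact .inr (.inr (recolor_injective c h))

lemma card_cornerTriples (c : CCube) : (cornerTriples c).card = 8 := by
  rw [cornerTriples_eq_image, Finset.card_image_of_injOn (injOn_cycClass_recolor c)]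
  rfl

lemma card_filter_isClockwise_recolor : ∀ p : Equiv.Perm (Fin 6),
    (cornerReps.filter fun t => IsClockwise (recolor p t)).card = 0 ∨
    (cornerReps.filter fun t => IsClockwise (recolor p t)).card = 2 ∨
    (cornerReps.filter fun t => IsClockwise (recolor p t)).card = 8 := by
  decide +kernel

/-- Two cubes share no, two, or all of their eight corner triples. -/
lemma card_cornerTriples_inter (m c : CCube) :
    (cornerTriples m ∩ cornerTriples c).card = 0 ∨
    (cornerTriples m ∩ cornerTriples c).card = 2 ∨
    (cornerTriples m ∩ cornerTriples c).card = 8 := by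
  have h : cornerTriples m ∩ cornerTriples c =
      (cornerReps.filter fun t => IsClockwise (recolor (c⁻¹ * m) t)).image
        fun t => cycClass (recolor m t) := by
    ext s
    rw [Finset.mem_inter, cornerTriples_eq_image m, Finset.mem_image, Finset.mem_image]
    constructor
    · rintro ⟨⟨t, ht, rfl⟩, hc⟩
      exact ⟨t, Finset.mem_filter.2 ⟨ht, cycClass_mem_cornerTriples.1 hc⟩, rfl⟩
    · rintro ⟨t, ht, rfl⟩
      rw [Finset.mem_filter] at ht
      exact ⟨⟨t, ht.1, rfl⟩, cycClass_mem_cornerTriples.2 ht.2⟩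
  rw [h, Finset.card_image_of_injOn ((injOn_cycClass_recolor m).mono
    (Finset.coe_subset.2 (Finset.filter_subset _ _)))]
  exact card_filter_isClockwise_recolor _

lemma cornerTriples_eq_of_sameVariety {c d : CCube} (h : sameVariety c d) :
    cornerTriples d = cornerTriples c := by
  obtain ⟨g, hg, rfl⟩ := h
  ext s
  simp only [mem_cornerTriples]
  constructor
  · rintro ⟨t, ht, rfl⟩
    exact ⟨recolor g t, (isClockwise_recolor_of_mem hg t).2 ht, rfl⟩
  · rintro ⟨t, ht, rfl⟩
    refine ⟨recolor g⁻¹ t, (isClockwise_recolor_of_mem (G.inv_mem hg) t).2 ht, ?_⟩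
    rw [recolor_mul, recolor_recolor_inv]

lemma vCorners_varietyOf (c : CCube) : vCorners (varietyOf c) = cornerTriples c :=
  (cornerTriples_eq_of_sameVariety (Quotient.mk_out (s := varietySetoid) c)).symm

/-- If five varieties pairwise share no corner triples, then at most seven cubes of each of
three of them and at most one of each of the other two do not suffice for a corner solution. -/
lemma not_hasCornerSolution {v : Fin 5 → Variety}
    (hdisj : ∀ i j, i ≠ j → Disjoint (vCorners (v i)) (vCorners (v j)))
    {S : Multiset CCube} (hS : ∀ x ∈ S, ∃ i, varietyOf x = v i)
    (hcard : ∀ i, Multiset.card (S.filter fun x => varietyOf x = v i) ≤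
      (![7, 7, 7, 1, 1] : Fin 5 → ℕ) i) :
    ¬ HasCornerSolution S := by
  rintro ⟨m, ψ, hle, hψ⟩
  have hvar : ∀ t ∈ cornerTriples m, ∃ i, varietyOf (ψ t) = v i := fun t ht =>
    hS _ (Multiset.mem_of_le hle (Multiset.mem_map_of_mem ψ ht))
  have hmem : ∀ t ∈ cornerTriples m, ∀ i, varietyOf (ψ t) = v i → t ∈ vCorners (v i) := by
    intro t ht i hi
    rw [← hi, vCorners_varietyOf]
    exact hψ t ht
  have hinter : ∀ i, (cornerTriples m).filter (fun t => varietyOf (ψ t) = v i) =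
      cornerTriples m ∩ vCorners (v i) := by
    intro i
    ext t
    rw [Finset.mem_filter, Finset.mem_inter]
    refine and_congr_right fun ht => ⟨hmem t ht i, fun hti => ?_⟩
    obtain ⟨j, hj⟩ := hvar t ht
    by_cases hij : i = j
    · rw [hj, hij]
    · exact absurd (hmem t ht j hj) (Finset.disjoint_left.1 (hdisj i j hij) hti)
  have hcover : (Finset.univ : Finset (Fin 5)).biUnion
      (fun i => cornerTriples m ∩ vCorners (v i)) = cornerTriples m := by
    ext t
    simp only [Finset.mem_biUnion, Finset.mem_univ, true_and, Finset.mem_inter]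
    refine ⟨fun ⟨_, h⟩ => h.1, fun ht => ?_⟩
    obtain ⟨i, hi⟩ := hvar t ht
    exact ⟨i, ht, hmem t ht i hi⟩
  have hsum : ∑ i, (cornerTriples m ∩ vCorners (v i)).card = 8 := by
    rw [← card_cornerTriples m, ← Finset.card_biUnion, hcover]
    exact fun i _ j _ hij => (hdisj i j hij).mono Finset.inter_subset_right
      Finset.inter_subset_right
  have hbound : ∀ i, (cornerTriples m ∩ vCorners (v i)).card ≤
      (![7, 7, 7, 1, 1] : Fin 5 → ℕ) i := by
    intro i
    refine le_trans ?_ (hcard i)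
    have h := Multiset.card_le_card (Multiset.filter_le_filter (fun x => varietyOf x = v i) hle)
    rw [Multiset.filter_map, Multiset.card_map] at h
    rw [← hinter i]
    exact h
  have hval := fun i => card_cornerTriples_inter m (Quotient.out (v i))
  simp only [← vCorners.eq_def] at hval
  rw [Fin.sum_univ_five] at hsum
  have b0 := hbound 0
  have b1 := hbound 1
  have b2 := hbound 2
  have b3 := hbound 3
  have b4 := hbound 4
  simp at b0 b1 b2 b3 b4
  have := hval 0
  have := hval 1
  have := hval 2
  have := hval 3
  have := hval 4
  omega

/-- A cyclic permutation of five colors whose powers have pairwise disjoint corner triples. -/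
def fiveCycle : CCube := ([0, 1, 2, 4, 3] : List (Fin 6)).formPerm

lemma not_isClockwise_fiveCycle_pow : ∀ i j : Fin 5, i ≠ j → ∀ t : Triple, IsClockwise t →
    ¬ IsClockwise (recolor ((fiveCycle ^ j.val)⁻¹ * fiveCycle ^ i.val) t) := by
  decide +kernel

lemma disjoint_cornerTriples_fiveCycle_pow {i j : Fin 5} (hij : i ≠ j) :
    Disjoint (cornerTriples (fiveCycle ^ i.val)) (cornerTriples (fiveCycle ^ j.val)) := by
  rw [Finset.disjoint_left]
  intro s hi hj
  obtain ⟨t, ht, rfl⟩ := mem_cornerTriples.1 hi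
  exact not_isClockwise_fiveCycle_pow i j hij t ht (cycClass_mem_cornerTriples.1 hj)

lemma varietyOf_fiveCycle_pow_injective :
    Function.Injective fun i : Fin 5 => varietyOf (fiveCycle ^ i.val) := by
  intro i j h
  by_contra hij
  have hd := disjoint_cornerTriples_fiveCycle_pow hij
  rw [← vCorners_varietyOf, ← vCorners_varietyOf (fiveCycle ^ j.val)] at hd
  simp only at h
  rw [h, disjoint_self, vCorners_varietyOf] at hd
  simpa [hd] using card_cornerTriples (fiveCycle ^ j.val)

lemma exists_card_eq_not_hasCornerSolution :
    ∃ S : Multiset CCube, Multiset.card S = 23 ∧ ¬ HasCornerSolution S := by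
  refine ⟨∑ i : Fin 5, Multiset.replicate ((![7, 7, 7, 1, 1] : Fin 5 → ℕ) i)
    (fiveCycle ^ i.val), by simp [Fin.sum_univ_five],
    not_hasCornerSolution (v := fun i => varietyOf (fiveCycle ^ i.val)) ?_ ?_ ?_⟩
  · intro i j hij
    simpa only [vCorners_varietyOf] using disjoint_cornerTriples_fiveCycle_pow hij
  · intro x hx
    obtain ⟨i, -, hi⟩ := Multiset.mem_sum.1 hx
    exact ⟨i, by rw [Multiset.eq_of_mem_replicate hi]⟩
  · intro i
    have hiff : ∀ j : Fin 5, varietyOf (fiveCycle ^ j.val) = varietyOf (fiveCycle ^ i.val) ↔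
        j = i := fun j => varietyOf_fiveCycle_pow_injective.eq_iff
    rw [← Multiset.countP_eq_card_filter, ← Multiset.coe_countPAddMonoidHom, map_sum]
    simp only [Multiset.coe_countPAddMonoidHom, ← Multiset.coe_replicate, Multiset.coe_countP,
      List.countP_replicate, hiff, decide_eq_true_eq, Finset.sum_ite_eq', Finset.mem_univ,
      if_true, le_refl]

/-- For every pentad, a multiset of 23 cubes consisting of seven cubes of each of three of
its varieties and one cube of each of the other two contains no corner solution.  In
particular there is a multiset of 23 colored cubes containing no corner solution. -/
theorem pentad_counterexample :
    (∀ P : Finset Variety, IsPentad P →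
      ∀ v : Fin 5 → Variety, Function.Injective v →
        P = {v 0, v 1, v 2, v 3, v 4} →
        ∀ S : Multiset CCube,
          (∀ x ∈ S, varietyOf x ∈ P) →
          Multiset.card (S.filter (fun x => varietyOf x = v 0)) = 7 →
          Multiset.card (S.filter (fun x => varietyOf x = v 1)) = 7 →
          Multiset.card (S.filter (fun x => varietyOf x = v 2)) = 7 →
          Multiset.card (S.filter (fun x => varietyOf x = v 3)) = 1 →
          Multiset.card (S.filter (fun x => varietyOf x = v 4)) = 1 →
          ¬ HasCornerSolution S) ∧
    ∃ S : Multiset CCube, Multiset.card S = 23 ∧ ¬ HasCornerSolution S := by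
  refine ⟨?_, exists_card_eq_not_hasCornerSolution⟩
  intro P hP v hv hPv S hS h0 h1 h2 h3 h4
  have hmem : ∀ i, v i ∈ P := by
    intro i
    rw [hPv]
    fin_cases i <;> simp
  refine not_hasCornerSolution (v := v) (fun i j hij => ?_) (fun x hx => ?_) (fun i => ?_)
  · exact Finset.disjoint_iff_inter_eq_empty.2
      (hP.2.1 _ (hmem i) _ (hmem j) (hv.ne hij))
  · have h := hS x hx
    simp only [hPv, Finset.mem_insert, Finset.mem_singleton] at h
    rcases h with h | h | h | h | h
    exacts [⟨_, h⟩, ⟨_, h⟩, ⟨_, h⟩, ⟨_, h⟩, ⟨_, h⟩]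
  · fin_cases i
    exacts [h0.le, h1.le, h2.le, h3.le, h4.le]
end

section
/- Fix an unordered pair {a, b} of distinct colors. If v, w1, w2 are three distinct varieties each having {a, b} as an opposite pair, with w1 ≠ v* and w2 ≠ v*, then the multiset consisting of four cubes of variety v, two cubes of variety w1, and two cubes of variety w2 contains a corner solution modeled on v. Likewise, the multiset consisting of six cubes of variety v together with any two cubes whose varieties have {a, b} as an opposite pair and are different from v* contains a corner solution modeled on v. -/
open scoped Classical

theorem varietyOf_eq_iff {c d : CCube} : varietyOf c = varietyOf d ↔ ∃ g ∈ G, d = c * g :=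
  Quotient.eq (r := varietySetoid)

theorem varietyOf_mul {g : Equiv.Perm (Fin 6)} (hg : g ∈ G) (c : CCube) :
    varietyOf (c * g) = varietyOf c :=
  (varietyOf_eq_iff.2 ⟨g, hg, rfl⟩).symm

theorem r1_mem : r1 ∈ G := Subgroup.subset_closure (by simp)

theorem r2_mem : r2 ∈ G := Subgroup.subset_closure (by simp)

theorem r2_pow_mem (n : ℕ) : r2 ^ n ∈ G := G.pow_mem r2_mem n

/-- The corner triple at the faces `0, 1, 2`. -/
def corner (c : CCube) : Finset (Fin 6 × Fin 6 × Fin 6) := cycClass (c 0, c 1, c 2)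

theorem corner_mul (σ c : CCube) :
    corner (σ * c) = (corner c).image (Prod.map σ (Prod.map σ σ)) := by
  simp [corner, cycClass, cyc, Finset.image_insert]

theorem corner_mul_congr {c d : CCube} (σ : CCube) (h : corner c = corner d) :
    corner (σ * c) = corner (σ * d) := by
  rw [corner_mul, corner_mul, h]

theorem corner_mul_inj {σ c d : CCube} (h : corner (σ * c) = corner (σ * d)) :
    corner c = corner d := by
  simpa using corner_mul_congr σ⁻¹ h

theorem mem_cornerTriples_s15 {c : CCube} {s : Finset (Fin 6 × Fin 6 × Fin 6)} :
    s ∈ cornerTriples c ↔ ∃ g ∈ G, s = corner (c * g) := by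
  simp [cornerTriples, corner]

theorem corner_mem_cornerTriples {c d : CCube} (h : varietyOf c = varietyOf d) :
    corner c ∈ cornerTriples d := by
  obtain ⟨g, hg, rfl⟩ := varietyOf_eq_iff.1 h.symm
  exact mem_cornerTriples_s15.2 ⟨g, hg, rfl⟩

theorem cornerTriples_congr {c d : CCube} (h : varietyOf c = varietyOf d) :
    cornerTriples c = cornerTriples d := by
  ext s
  constructor <;> intro hs <;> obtain ⟨g, hg, rfl⟩ := mem_cornerTriples_s15.1 hs
  · exact corner_mem_cornerTriples ((varietyOf_mul hg c).trans h)
  · exact corner_mem_cornerTriples ((varietyOf_mul hg d).trans h.symm)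

/-- A half-turn carrying the faces `0, 1, 2` to `3, 2, 1`. -/
def edgeFlip : Equiv.Perm (Fin 6) := r2⁻¹ * r1 ^ 2

theorem edgeFlip_mem : edgeFlip ∈ G := G.mul_mem (G.inv_mem r2_mem) (G.pow_mem r1_mem 2)

/-- Rotations carrying the corner `0, 1, 2` to each of the eight corners; the first index selects
one of the four edges not meeting the faces `0` and `3`, the second an endpoint of that edge. -/
def toCorner (k : Fin 4 × Fin 2) : Equiv.Perm (Fin 6) := r2 ^ (k.1 : ℕ) * edgeFlip ^ (k.2 : ℕ)

theorem toCorner_mem (k : Fin 4 × Fin 2) : toCorner k ∈ G :=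
  G.mul_mem (r2_pow_mem _) (G.pow_mem edgeFlip_mem _)

theorem corner_toCorner_injective : Function.Injective fun k => corner (toCorner k) := by
  unfold Function.Injective
  decide +kernel

theorem exists_corner_eq_toCorner {g : Equiv.Perm (Fin 6)} (hg : g ∈ G) :
    ∃ k, corner g = corner (toCorner k) := by
  have step : ∀ k, ∀ σ ∈ [r1, r2, r1⁻¹, r2⁻¹],
      ∃ k', corner (σ * toCorner k) = corner (toCorner k') := by decide +kernel
  have lift (σ) (hσ : σ ∈ [r1, r2, r1⁻¹, r2⁻¹]) (y : Equiv.Perm (Fin 6))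
      (hy : ∃ k, corner y = corner (toCorner k)) : ∃ k, corner (σ * y) = corner (toCorner k) := by
    obtain ⟨k, hk⟩ := hy
    rw [corner_mul_congr σ hk]
    exact step k σ hσ
  induction hg using Subgroup.closure_induction_left with
  | one => exact ⟨(0, 0), rfl⟩
  | mul_left x hx y _ ih => exact lift x (by rcases hx with rfl | rfl <;> simp) y ih
  | inv_mul_cancel x hx y _ ih => exact lift x⁻¹ (by rcases hx with rfl | rfl <;> simp) y ih

theorem cornerTriples_val (m : CCube) :
    (cornerTriples m).val = Finset.univ.val.map fun k => corner (m * toCorner k) := by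
  have hinj : Function.Injective fun k => corner (m * toCorner k) :=
    fun _ _ h => corner_toCorner_injective (corner_mul_inj h)
  suffices cornerTriples m = Finset.univ.map ⟨_, hinj⟩ by rw [this]; rfl
  ext s
  simp only [mem_cornerTriples_s15, Finset.mem_map, Finset.mem_univ, true_and,
    Function.Embedding.coeFn_mk]
  constructor
  · rintro ⟨g, hg, rfl⟩
    obtain ⟨k, hk⟩ := exists_corner_eq_toCorner hg
    exact ⟨k, (corner_mul_congr m hk).symm⟩
  · rintro ⟨k, rfl⟩
    exact ⟨_, toCorner_mem k, rfl⟩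

theorem cornerSolutionOn_map {m : CCube} {f : Fin 4 × Fin 2 → CCube}
    (hf : ∀ k, corner (m * toCorner k) ∈ cornerTriples (f k)) :
    CornerSolutionOn (Finset.univ.val.map f) m := by
  have hinj : Function.Injective fun k => corner (m * toCorner k) :=
    fun _ _ h => corner_toCorner_injective (corner_mul_inj h)
  refine ⟨f ∘ Function.invFun fun k => corner (m * toCorner k), ?_, fun t ht => ?_⟩
  · rw [cornerTriples_val, Multiset.map_map, Function.comp_assoc, Function.invFun_comp hinj]
    rfl
  · rw [← Finset.mem_val, cornerTriples_val, Multiset.mem_map] at ht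
    obtain ⟨k, -, rfl⟩ := ht
    simpa only [Function.comp_apply, Function.leftInverse_invFun hinj k] using hf k

theorem CornerSolutionOn.congr {S : Multiset CCube} {m m' : CCube}
    (h : varietyOf m = varietyOf m') (hm : CornerSolutionOn S m) : CornerSolutionOn S m' := by
  unfold CornerSolutionOn at *
  rwa [← cornerTriples_congr h]

theorem exists_rotation (k : Fin 6) : ∃ g ∈ G, g 0 = k ∧ g 3 = tau k := by
  have h1 := r1_mem
  have h2 := r2_mem
  fin_cases k
  · exact ⟨1, G.one_mem, by decide⟩
  · exact ⟨r1, h1, by decide⟩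
  · exact ⟨r2 * r1, G.mul_mem h2 h1, by decide⟩
  · exact ⟨r1 ^ 2, G.pow_mem h1 2, by decide⟩
  · exact ⟨r1⁻¹, G.inv_mem h1, by decide⟩
  · exact ⟨r2⁻¹ * r1, G.mul_mem (G.inv_mem h2) h1, by decide⟩

theorem exists_representative {a b : Fin 6} {v : Variety}
    (h : ({a, b} : Finset (Fin 6)) ∈ vOpp v) :
    ∃ m : CCube, varietyOf m = v ∧ m 0 = a ∧ m 3 = b := by
  obtain ⟨i, -, hi⟩ := Finset.mem_image.1 h
  obtain ⟨k, ha, hb⟩ : ∃ k, Quotient.out v k = a ∧ Quotient.out v (tau k) = b := by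
    have hi' : ({Quotient.out v i, Quotient.out v (tau i)} : Set (Fin 6)) = {a, b} := by
      simpa using congrArg (fun s : Finset (Fin 6) => (s : Set (Fin 6))) hi
    rcases Set.pair_eq_pair_iff.1 hi' with ⟨ha, hb⟩ | ⟨hb, ha⟩
    · exact ⟨i, ha, hb⟩
    · exact ⟨tau i, ha, by rwa [show tau (tau i) = i by clear * - ; revert i; decide]⟩
  obtain ⟨g, hg, h0, h3⟩ := exists_rotation k
  refine ⟨Quotient.out v * g, (varietyOf_mul hg _).trans (Quotient.out_eq v), ?_, ?_⟩
  · simp [h0, ha]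
  · simp [h3, hb]

theorem swap_conj_mem {g : Equiv.Perm (Fin 6)} (hg : g ∈ G) :
    Equiv.swap 0 3 * g * Equiv.swap 0 3 ∈ G := by
  have key : G ≤ G.comap (MulAut.conj (Equiv.swap 0 3)).toMonoidHom := by
    refine (Subgroup.closure_le _).2 ?_
    rintro x (rfl | rfl)
    · have : MulAut.conj (Equiv.swap 0 3) r1 = r1⁻¹ := by decide +kernel
      simpa [this] using r1_mem
    · have : MulAut.conj (Equiv.swap 0 3) r2 = r2 := by decide +kernel
      simpa [this] using r2_mem
  simpa using key hg

theorem vMirror_varietyOf (m : CCube) : vMirror (varietyOf m) = varietyOf (m * Equiv.swap 1 4) := by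
  obtain ⟨g, hg, h⟩ := varietyOf_eq_iff.1 (Quotient.out_eq (varietyOf m))
  have hs : Equiv.swap 0 3 * Equiv.swap 1 4 = r1 ^ 2 := by decide +kernel
  refine varietyOf_eq_iff.2 ⟨_, G.mul_mem (swap_conj_mem hg) (G.pow_mem r1_mem 2), ?_⟩
  generalize Quotient.out (varietyOf m) = c at h
  rw [h, mirror, ← hs]
  simp [mul_assoc]

theorem perm_fixing_poles (π : Equiv.Perm (Fin 6)) (h0 : π 0 = 0) (h3 : π 3 = 3) :
    (∃ j : Fin 4, π = r2 ^ (j : ℕ)) ∨ (∃ j : Fin 4, π = Equiv.swap 1 4 * r2 ^ (j : ℕ)) ∨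
      ∃ i j : Fin 4, π = r2 ^ (i : ℕ) * Equiv.swap 4 5 * r2 ^ (j : ℕ) := by
  revert π
  decide +kernel

/-- The cubes with the same opposite faces `0`, `3` as `m` and a variety other than that of `m`
and its mirror are, up to rotation, those obtained from `m` by keeping one of the four edges
around and exchanging the remaining two faces. -/
theorem variety_cases {a b : Fin 6} {m : CCube} (ha : m 0 = a) (hb : m 3 = b) {w : Variety}
    (hw : ({a, b} : Finset (Fin 6)) ∈ vOpp w) (hmirror : w ≠ vMirror (varietyOf m)) :
    w = varietyOf m ∨ ∃ i : Fin 4, w = varietyOf (m * (r2 ^ (i : ℕ) * Equiv.swap 4 5)) := by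
  obtain ⟨d, rfl, h0, h3⟩ := exists_representative hw
  have hd : d = m * (m⁻¹ * d) := by group
  rcases perm_fixing_poles (m⁻¹ * d) (by simp [h0, ← ha]) (by simp [h3, ← hb]) with
    ⟨j, hj⟩ | ⟨j, hj⟩ | ⟨i, j, hj⟩ <;> rw [hj] at hd
  · exact .inl (hd ▸ varietyOf_mul (r2_pow_mem _) m)
  · refine absurd ?_ hmirror
    rw [vMirror_varietyOf, hd, ← mul_assoc, varietyOf_mul (r2_pow_mem _)]
  · exact .inr ⟨i, by rw [hd, ← mul_assoc, varietyOf_mul (r2_pow_mem _)]⟩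

theorem corner_mem_of_edge {m d : CCube} {i : Fin 4}
    (h : varietyOf d = varietyOf (m * (r2 ^ (i : ℕ) * Equiv.swap 4 5))) (j : Fin 2) :
    corner (m * toCorner (i, j)) ∈ cornerTriples d := by
  have hc : ∀ (i : Fin 4) (j : Fin 2), corner (toCorner (i, j)) =
      corner (r2 ^ (i : ℕ) * Equiv.swap 4 5 * edgeFlip ^ (j : ℕ)) := by decide +kernel
  rw [corner_mul_congr m (hc i j), ← mul_assoc]
  exact corner_mem_cornerTriples ((varietyOf_mul (G.pow_mem edgeFlip_mem _) _).trans h.symm)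

theorem corner_mem_of_variety_eq {m d : CCube} (h : varietyOf d = varietyOf m)
    (k : Fin 4 × Fin 2) : corner (m * toCorner k) ∈ cornerTriples d :=
  corner_mem_cornerTriples ((varietyOf_mul (toCorner_mem k) m).trans h.symm)

theorem exists_common_edge {a b : Fin 6} {m d : CCube} (ha : m 0 = a) (hb : m 3 = b)
    (hd : ({a, b} : Finset (Fin 6)) ∈ vOpp (varietyOf d))
    (hmirror : varietyOf d ≠ vMirror (varietyOf m)) :
    ∃ i : Fin 4, ∀ j, corner (m * toCorner (i, j)) ∈ cornerTriples d := by
  rcases variety_cases ha hb hd hmirror with h | ⟨i, h⟩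
  · exact ⟨0, fun j => corner_mem_of_variety_eq h _⟩
  · exact ⟨i, corner_mem_of_edge h⟩

/-- Four cubes of variety `v` together with two cubes of each of two other varieties sharing
the opposite pair `{a, b}` and different from the mirror variety of `v` form a corner
solution modeled on `v`; likewise six cubes of variety `v` together with any two cubes whose
varieties have `{a, b}` as an opposite pair and differ from the mirror variety of `v`. -/
theorem make_corner_solution (a b : Fin 6) (hab : a ≠ b) :
    (∀ v w1 w2 : Variety, v ≠ w1 → v ≠ w2 → w1 ≠ w2 →
      ({a, b} : Finset (Fin 6)) ∈ vOpp v → ({a, b} : Finset (Fin 6)) ∈ vOpp w1 →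
      ({a, b} : Finset (Fin 6)) ∈ vOpp w2 →
      w1 ≠ vMirror v → w2 ≠ vMirror v →
      ∀ cv c1 c2 : CCube, varietyOf cv = v → varietyOf c1 = w1 → varietyOf c2 = w2 →
        CornerSolutionOn (Multiset.replicate 4 cv + Multiset.replicate 2 c1 +
          Multiset.replicate 2 c2) cv) ∧
    ∀ v : Variety, ({a, b} : Finset (Fin 6)) ∈ vOpp v →
      ∀ cv d1 d2 : CCube, varietyOf cv = v →
        ({a, b} : Finset (Fin 6)) ∈ vOpp (varietyOf d1) → varietyOf d1 ≠ vMirror v →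
        ({a, b} : Finset (Fin 6)) ∈ vOpp (varietyOf d2) → varietyOf d2 ≠ vMirror v →
        CornerSolutionOn (Multiset.replicate 6 cv + {d1, d2}) cv := by
  constructor
  · intro v w1 w2 h1 h2 h12 hv hw1 hw2 hm1 hm2 cv c1 c2 hcv hc1 hc2
    obtain ⟨m, rfl, ha, hb⟩ := exists_representative hv
    obtain ⟨i1, hi1⟩ := (variety_cases ha hb hw1 hm1).resolve_left h1.symm
    obtain ⟨i2, hi2⟩ := (variety_cases ha hb hw2 hm2).resolve_left h2.symm
    have hne : i1 ≠ i2 := fun h => h12 (by rw [hi1, hi2, h])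
    let label : Fin 4 × Fin 2 → Fin 3 := fun k => if k.1 = i1 then 1 else if k.1 = i2 then 2 else 0
    have hlabel : Finset.univ.val.map label =
        Multiset.replicate 4 0 + Multiset.replicate 2 1 + Multiset.replicate 2 2 := by
      clear * - hne
      revert i1 i2
      decide +kernel
    have key : CornerSolutionOn (Finset.univ.val.map (![cv, c1, c2] ∘ label)) m := by
      refine cornerSolutionOn_map fun ⟨i, j⟩ => ?_
      by_cases e1 : i = i1
      · simpa [label, e1] using corner_mem_of_edge (hc1.trans hi1) j
      by_cases e2 : i = i2
      · simpa [label, e2, hne.symm] using corner_mem_of_edge (hc2.trans hi2) j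
      · simpa [label, e1, e2] using corner_mem_of_variety_eq hcv (i, j)
    rw [← Multiset.map_map, hlabel] at key
    simpa using key.congr hcv.symm
  · intro v hv cv d1 d2 hcv hd1 hm1 hd2 hm2
    obtain ⟨m, rfl, ha, hb⟩ := exists_representative hv
    obtain ⟨i1, hi1⟩ := exists_common_edge ha hb hd1 hm1
    obtain ⟨i2, hi2⟩ := exists_common_edge ha hb hd2 hm2
    let label : Fin 4 × Fin 2 → Fin 3 := fun k =>
      if k = (i1, 0) then 1 else if k = (i2, 1) then 2 else 0
    have hlabel : Finset.univ.val.map label = Multiset.replicate 6 0 + {1, 2} := by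
      clear * -
      revert i1 i2
      decide +kernel
    have key : CornerSolutionOn (Finset.univ.val.map (![cv, d1, d2] ∘ label)) m := by
      refine cornerSolutionOn_map fun k => ?_
      by_cases e1 : k = (i1, 0)
      · simpa [label, e1] using hi1 0
      by_cases e2 : k = (i2, 1)
      · simpa [label, e2] using hi2 1
      · simpa [label, e1, e2] using corner_mem_of_variety_eq hcv k
    rw [← Multiset.map_map, hlabel] at key
    simpa using key.congr hcv.symm
end
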